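/- arXiv:2305.11848 — 2 statements merged into one kernel-verified Lean document; each statement's English description precedes it below -/
import Mathlib

section
/- Let d ≥ 1, T > 0, and constants L, L̄ > 0. Let P₁ denote the set of Borel probability measures on ℝ^d with finite first moment, and for ν ∈ P₁ write ‖ν‖₁ := ∫‖y‖dν(y). Let B : [0,T] × ℝ^d × P₁ → ℝ^d satisfy: (i) for each fixed (x,ν), s ↦ B(s,x,ν) is continuous on [0,T]; (ii) for all s, x, x', ν, ν' and every coupling π of ν and ν': ‖B(s,x,ν) − B(s,x',ν')‖ ≤ L(‖x−x'‖ + ∫‖y−y'‖dπ(y,y')); (iii) ‖B(s,x,ν)‖ ≤ L̄(1+‖x‖+‖ν‖₁). Then for every t ∈ [0,T] and every m ∈ P₁ there exists a unique jointly continuous X : [t,T] × ℝ^d → ℝ^d, (s,x) ↦ X_s(x), with sup_{s∈[t,T], x∈ℝ^d} ‖X_s(x)‖/(1+‖x‖+‖m‖₁) < ∞, satisfying the McKean–Vlasov integral equation X_s(x) = x + ∫_t^s B(τ, X_τ(x), (X_τ)_#m) dτ for all s ∈ [t,T] and x ∈ ℝ^d, where (X_τ)_#m is the pushforward of m by X_τ.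 Moreover this solution satisfies sup_{s∈[t,T]} ∫‖X_s(y)‖dm(y) ≤ (‖m‖₁ + L̄(T−t)) e^{2L̄(T−t)}, and for every x, sup_{s∈[t,T]} ‖X_s(x)‖ ≤ (‖x‖ + L̄(1 + sup_{s∈[t,T]}∫‖X_s(y)‖dm(y))(T−t)) e^{L̄(T−t)}. -/
open MeasureTheory Set

/-- Probability measures on `ℝ^d` with finite first moment. -/
def MemP1 {d : ℕ} (μ : Measure (EuclideanSpace ℝ (Fin d))) : Prop :=
  IsProbabilityMeasure μ ∧ Integrable (fun x => ‖x‖) μ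

/-- `π` is a coupling of `μ` and `ν`. -/
def IsCoupling {d : ℕ} (π : Measure (EuclideanSpace ℝ (Fin d) × EuclideanSpace ℝ (Fin d)))
    (μ ν : Measure (EuclideanSpace ℝ (Fin d))) : Prop :=
  IsProbabilityMeasure π ∧ π.map Prod.fst = μ ∧ π.map Prod.snd = ν

/-- The first moment `‖ν‖₁ = ∫ ‖y‖ dν(y)`. -/
noncomputable def mnorm1 {d : ℕ} (ν : Measure (EuclideanSpace ℝ (Fin d))) : ℝ :=
  ∫ y, ‖y‖ ∂ν

/-- Integral form of Grönwall's inequality. -/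
lemma le_mul_exp_of_le_add_integral {φ : ℝ → ℝ} {A c a b : ℝ} (hc : 0 ≤ c) (hφ : Continuous φ)
    (h : ∀ s ∈ Icc a b, φ s ≤ A + c * ∫ τ in a..s, φ τ) :
    ∀ s ∈ Icc a b, φ s ≤ A * Real.exp (c * (s - a)) := by
  intro s hs
  have hd : ∀ x, HasDerivAt (fun s => A + c * ∫ τ in a..s, φ τ) (c * φ x) x := fun x =>
    ((intervalIntegral.integral_hasDerivAt_right (hφ.intervalIntegrable _ _)
      (hφ.stronglyMeasurableAtFilter _ _) hφ.continuousAt).const_mul c).const_add A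
  have hg := le_gronwallBound_of_liminf_deriv_right_le (f' := fun x => c * φ x) (δ := A) (K := c)
    (ε := 0) (fun x _ => (hd x).continuousAt.continuousWithinAt)
    (fun x _ r hr => ((hd x).hasDerivWithinAt.liminf_right_slope_le hr)) (by simp)
    (fun x hx => by
      simpa using mul_le_mul_of_nonneg_left (h x (Ico_subset_Icc_self hx)) hc) s hs
  rw [gronwallBound_ε0] at hg
  exact (h s hs).trans hg

section MeanField

variable {E F : Type*} [NormedAddCommGroup E] [NormedAddCommGroup F]

/-- Continuous time-dependent maps whose growth in space is linear, uniformly in time. -/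
def UnifLinearGrowth (Z : ℝ × E → F) : Prop :=
  Continuous Z ∧ ∃ K, 0 ≤ K ∧ ∀ q, ‖Z q‖ ≤ K * (1 + ‖q.2‖)

/-- Continuous maps of linear growth. -/
def LinearGrowth (f : E → F) : Prop :=
  Continuous f ∧ ∃ K, 0 ≤ K ∧ ∀ y, ‖f y‖ ≤ K * (1 + ‖y‖)

lemma UnifLinearGrowth.slice {Z : ℝ × E → F} (hZ : UnifLinearGrowth Z) (s : ℝ) :
    LinearGrowth fun y => Z (s, y) :=
  ⟨hZ.1.comp (by fun_prop), hZ.2.imp fun _ h => ⟨h.1, fun y => h.2 (s, y)⟩⟩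

lemma UnifLinearGrowth.norm {Z : ℝ × E → F} (hZ : UnifLinearGrowth Z) :
    UnifLinearGrowth fun q => ‖Z q‖ :=
  ⟨hZ.1.norm, hZ.2.imp fun _ h => ⟨h.1, fun q => by simpa using h.2 q⟩⟩

lemma LinearGrowth.sub {f g : E → F} (hf : LinearGrowth f) (hg : LinearGrowth g) :
    LinearGrowth fun y => f y - g y := by
  obtain ⟨hf, K, hK, hfK⟩ := hf
  obtain ⟨hg, K', hK', hgK⟩ := hg
  refine ⟨hf.sub hg, K + K', by positivity, fun y => (norm_sub_le _ _).trans ?_⟩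
  linarith [hfK y, hgK y]

lemma UnifLinearGrowth.sub_slice {Z : ℝ × E → F} (hZ : UnifLinearGrowth Z) (s : ℝ) :
    UnifLinearGrowth fun q : ℝ × E => Z q - Z (s, q.2) := by
  obtain ⟨hZ, K, hK, hZK⟩ := hZ
  refine ⟨by fun_prop, K + K, by positivity, fun q => (norm_sub_le _ _).trans ?_⟩
  linarith [hZK q, hZK (s, q.2)]

variable [MeasurableSpace E] {m : Measure E} [IsProbabilityMeasure m]

lemma integrable_mul_one_add_norm (hm : Integrable (fun y => ‖y‖) m) (K : ℝ) :
    Integrable (fun y => K * (1 + ‖y‖)) m :=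
  ((integrable_const 1).add hm).const_mul K

variable [BorelSpace E]

lemma LinearGrowth.integrable_norm (hm : Integrable (fun y => ‖y‖) m) {f : E → F}
    (hf : LinearGrowth f) : Integrable (fun y => ‖f y‖) m := by
  obtain ⟨hf, K, hK, hfK⟩ := hf
  exact (integrable_mul_one_add_norm hm K).mono' hf.norm.aestronglyMeasurable
    (.of_forall fun y => by simpa using hfK y)

lemma UnifLinearGrowth.continuous_integral_norm (hm : Integrable (fun y => ‖y‖) m) {Z : ℝ × E → F}
    (hZ : UnifLinearGrowth Z) : Continuous fun s => ∫ y, ‖Z (s, y)‖ ∂m := by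
  obtain ⟨hZ, K, hK, hZK⟩ := hZ
  refine continuous_of_dominated (bound := fun y => K * (1 + ‖y‖)) (fun s => ?_)
    (fun s => .of_forall fun y => by simpa using hZK (s, y)) (integrable_mul_one_add_norm hm K)
    (.of_forall fun y => by fun_prop)
  exact Continuous.aestronglyMeasurable (by fun_prop)

/-- A drift `b s x f`, where the function `f` stands for the law of `f` under `m`, which is
continuous in time, Lipschitz in `(x, f)` and of linear growth. -/
structure IsMeanFieldDrift (m : Measure E) (b : ℝ → E → (E → E) → E) (L Lb : ℝ) : Prop where
  continuous : ∀ x f, LinearGrowth f → Continuous fun s => b s x f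
  lipschitz : ∀ s x x' f g, LinearGrowth f → LinearGrowth g →
    ‖b s x f - b s x' g‖ ≤ L * (‖x - x'‖ + ∫ y, ‖f y - g y‖ ∂m)
  growth : ∀ s x f, LinearGrowth f → ‖b s x f‖ ≤ Lb * (1 + ‖x‖ + ∫ y, ‖f y‖ ∂m)

variable {b : ℝ → E → (E → E) → E} {L Lb : ℝ}

lemma IsMeanFieldDrift.continuous_comp (hm : Integrable (fun y => ‖y‖) m)
    (hb : IsMeanFieldDrift m b L Lb) {Z : ℝ × E → E} (hZ : UnifLinearGrowth Z) :
    Continuous fun q : ℝ × E => b q.1 (Z q) (fun y => Z (q.1, y)) := by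
  rw [continuous_iff_continuousAt]
  rintro ⟨s, x⟩
  rw [ContinuousAt, tendsto_iff_norm_sub_tendsto_zero]
  have h1 := (hZ.sub_slice s).continuous_integral_norm hm
  have h2 := hb.continuous (Z (s, x)) _ (hZ.slice s)
  have h3 := hZ.1
  have key : Continuous fun q : ℝ × E =>
      L * (‖Z q - Z (s, x)‖ + ∫ y, ‖Z (q.1, y) - Z (s, y)‖ ∂m) +
      ‖b q.1 (Z (s, x)) (fun y => Z (s, y)) - b s (Z (s, x)) (fun y => Z (s, y))‖ := by
    have h4 := h1.comp (continuous_fst (X := ℝ) (Y := E))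
    have h5 := h2.comp (continuous_fst (X := ℝ) (Y := E))
    simp only [Function.comp_def] at h4 h5
    fun_prop
  have hlim := key.tendsto (s, x)
  simp only [sub_self, norm_zero, integral_zero, add_zero, mul_zero] at hlim
  refine squeeze_zero (fun _ => norm_nonneg _) (fun q => ?_) hlim
  exact (norm_sub_le_norm_sub_add_norm_sub _ (b q.1 (Z (s, x)) fun y => Z (s, y)) _).trans
    (add_le_add_left (hb.lipschitz _ _ _ _ _ (hZ.slice _) (hZ.slice _)) _)

variable [NormedSpace ℝ E] {t T : ℝ}

lemma continuous_coe_projIcc (h : t ≤ T) : Continuous fun s => (projIcc t T h s : ℝ) :=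
  continuous_subtype_val.comp continuous_projIcc

/-- The Picard map of the mean-field equation on `[t, T]`; times outside are projected to it. -/
noncomputable def picardMap (b : ℝ → E → (E → E) → E) (h : t ≤ T) (Z : ℝ × E → E) : ℝ × E → E :=
  fun q => q.2 + ∫ τ in t..projIcc t T h q.1, b τ (Z (τ, q.2)) (fun y => Z (τ, y))

lemma IsMeanFieldDrift.unifLinearGrowth_picardMap (hm : Integrable (fun y => ‖y‖) m)
    (hb : IsMeanFieldDrift m b L Lb) (hLb : 0 ≤ Lb) (h : t ≤ T) {Z : ℝ × E → E}
    (hZ : UnifLinearGrowth Z) : UnifLinearGrowth (picardMap b h Z) := by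
  have hc := hb.continuous_comp hm hZ
  constructor
  · refine continuous_snd.add ?_
    refine intervalIntegral.continuous_parametric_intervalIntegral_of_continuous
      (f := fun (q : ℝ × E) τ => b τ (Z (τ, q.2)) (fun y => Z (τ, y))) (μ := volume) (a₀ := t)
      ?_ ((continuous_coe_projIcc h).comp continuous_fst)
    exact hc.comp (f := fun r : (ℝ × E) × ℝ => (r.2, r.1.2)) (by fun_prop)
  · obtain ⟨hZc, K, hK, hZK⟩ := hZ
    set M := ∫ y, K * (1 + ‖y‖) ∂m
    have hM : 0 ≤ M := integral_nonneg fun y => by positivity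
    have hTt : 0 ≤ T - t := sub_nonneg.2 h
    refine ⟨1 + Lb * (1 + K + M) * (T - t), by positivity, fun q => ?_⟩
    have hp := (projIcc t T h q.1).2
    have hb1 : ∀ τ, ‖b τ (Z (τ, q.2)) (fun y => Z (τ, y))‖ ≤ Lb * (1 + K + M) * (1 + ‖q.2‖) := by
      intro τ
      have hs := (UnifLinearGrowth.slice ⟨hZc, K, hK, hZK⟩ τ)
      refine (hb.growth _ _ _ hs).trans ?_
      rw [mul_assoc]
      refine mul_le_mul_of_nonneg_left ?_ hLb
      have : ∫ y, ‖Z (τ, y)‖ ∂m ≤ M :=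
        integral_mono (hs.integrable_norm hm) (integrable_mul_one_add_norm hm K) fun y => hZK (τ, y)
      have := hZK (τ, q.2)
      have : 0 ≤ M * ‖q.2‖ := by positivity
      dsimp only at *
      nlinarith [norm_nonneg q.2]
    have hintg := intervalIntegral.norm_integral_le_of_norm_le_const (a := t)
      (b := (projIcc t T h q.1 : ℝ)) fun τ _ => hb1 τ
    rw [abs_of_nonneg (sub_nonneg.2 hp.1)] at hintg
    have : Lb * (1 + K + M) * (1 + ‖q.2‖) * ((projIcc t T h q.1 : ℝ) - t) ≤
        Lb * (1 + K + M) * (1 + ‖q.2‖) * (T - t) := by gcongr; exact hp.2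
    have := norm_add_le q.2 (∫ τ in t..projIcc t T h q.1, b τ (Z (τ, q.2)) (fun y => Z (τ, y)))
    unfold picardMap
    linarith

/-- The Picard map is a contraction for distances weighted by `exp (c (s - t)) (1 + ‖x‖)` with
`c` large. -/
lemma IsMeanFieldDrift.norm_picardMap_sub_le (hm : Integrable (fun y => ‖y‖) m)
    (hb : IsMeanFieldDrift m b L Lb) (hL : 0 < L) (h : t ≤ T) {Z Z' : ℝ × E → E}
    (hZ : UnifLinearGrowth Z) (hZ' : UnifLinearGrowth Z') {c D : ℝ}
    (hc : c = 2 * L * (2 + ∫ y, ‖y‖ ∂m)) (hD : 0 ≤ D)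
    (hZZ' : ∀ s ∈ Icc t T, ∀ x, ‖Z (s, x) - Z' (s, x)‖ ≤
      D * (Real.exp (c * (s - t)) * (1 + ‖x‖))) {s : ℝ} (hs : s ∈ Icc t T) (x : E) :
    ‖picardMap b h Z (s, x) - picardMap b h Z' (s, x)‖ ≤
      D / 2 * (Real.exp (c * (s - t)) * (1 + ‖x‖)) := by
  have hc0 : 0 < c := by
    have : 0 ≤ ∫ y, ‖y‖ ∂m := integral_nonneg fun y => norm_nonneg y
    rw [hc]; positivity
  have hcont : ∀ {W : ℝ × E → E}, UnifLinearGrowth W →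
      Continuous fun τ => b τ (W (τ, x)) (fun y => W (τ, y)) := fun hW =>
    (hb.continuous_comp hm hW).comp (f := fun τ : ℝ => (τ, x)) (by fun_prop)
  simp only [picardMap, projIcc_of_mem h hs, add_sub_add_left_eq_sub]
  rw [← intervalIntegral.integral_sub ((hcont hZ).intervalIntegrable _ _)
    ((hcont hZ').intervalIntegrable _ _)]
  have hpt : ∀ τ ∈ Ioc t s, ‖b τ (Z (τ, x)) (fun y => Z (τ, y)) -
      b τ (Z' (τ, x)) (fun y => Z' (τ, y))‖ ≤
      D * (1 + ‖x‖) / 2 * (c * Real.exp (c * (τ - t))) := by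
    intro τ hτ
    have hτ' : τ ∈ Icc t T := ⟨hτ.1.le, hτ.2.trans hs.2⟩
    refine (hb.lipschitz _ _ _ _ _ (hZ.slice τ) (hZ'.slice τ)).trans ?_
    have hI : ∫ y, ‖Z (τ, y) - Z' (τ, y)‖ ∂m ≤
        D * Real.exp (c * (τ - t)) * (1 + ∫ y, ‖y‖ ∂m) := by
      calc _ ≤ ∫ y, D * Real.exp (c * (τ - t)) * (1 + ‖y‖) ∂m :=
            integral_mono (((hZ.slice τ).sub (hZ'.slice τ)).integrable_norm hm)
              (integrable_mul_one_add_norm hm _)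
              (fun y => (hZZ' τ hτ' y).trans_eq (by ring))
        _ = _ := by
            rw [integral_const_mul, integral_add (integrable_const _) hm]
            simp
    have h1 := hZZ' τ hτ' x
    have h0 : 0 ≤ (∫ y, ‖y‖ ∂m) * ‖x‖ :=
      mul_nonneg (integral_nonneg fun y => norm_nonneg y) (norm_nonneg x)
    calc _ ≤ L * (D * (Real.exp (c * (τ - t)) * (1 + ‖x‖)) +
          D * Real.exp (c * (τ - t)) * (1 + ∫ y, ‖y‖ ∂m)) := by gcongr
      _ = L * D * Real.exp (c * (τ - t)) * (2 + ‖x‖ + ∫ y, ‖y‖ ∂m) := by ring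
      _ ≤ L * D * Real.exp (c * (τ - t)) * ((1 + ‖x‖) * (2 + ∫ y, ‖y‖ ∂m)) := by
          gcongr
          nlinarith [norm_nonneg x]
      _ = _ := by rw [hc]; ring
  have hexp : ∀ τ, HasDerivAt (fun τ => Real.exp (c * (τ - t))) (c * Real.exp (c * (τ - t))) τ := by
    intro τ
    simpa [mul_comm] using (((hasDerivAt_id τ).sub_const t).const_mul c).exp
  have hintg : ∫ τ in t..s, c * Real.exp (c * (τ - t)) = Real.exp (c * (s - t)) - 1 := by
    rw [intervalIntegral.integral_eq_sub_of_hasDerivAt (fun τ _ => hexp τ)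
      (Continuous.intervalIntegrable (by fun_prop) _ _)]
    simp
  calc _ ≤ ∫ τ in t..s, D * (1 + ‖x‖) / 2 * (c * Real.exp (c * (τ - t))) :=
        intervalIntegral.norm_integral_le_of_norm_le hs.1 (.of_forall hpt)
          (Continuous.intervalIntegrable (by fun_prop) _ _)
    _ = D * (1 + ‖x‖) / 2 * (Real.exp (c * (s - t)) - 1) := by
        rw [intervalIntegral.integral_const_mul, hintg]
    _ ≤ D * (1 + ‖x‖) / 2 * Real.exp (c * (s - t)) := by
        gcongr; linarith
    _ = _ := by ring

open scoped BoundedContinuousFunction in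
/-- Well-posedness of the mean-field equation among maps of linear growth. -/
theorem IsMeanFieldDrift.existsUnique_picardMap_eq [CompleteSpace E]
    (hm : Integrable (fun y => ‖y‖) m) (hb : IsMeanFieldDrift m b L Lb) (hL : 0 < L)
    (hLb : 0 ≤ Lb) (h : t ≤ T) :
    ∃! Z : ℝ × E → E, UnifLinearGrowth Z ∧ picardMap b h Z = Z := by
  set c := 2 * L * (2 + ∫ y, ‖y‖ ∂m) with hc
  have hc0 : 0 < c := by
    have : 0 ≤ ∫ y, ‖y‖ ∂m := integral_nonneg fun y => norm_nonneg y
    positivity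
  let p : ℝ → ℝ := fun s => projIcc t T h s
  have hp : Continuous p := continuous_coe_projIcc h
  have hpm : ∀ s, p s ∈ Icc t T := fun s => (projIcc t T h s).2
  have hpp : ∀ s, projIcc t T h (p s) = projIcc t T h s := fun s => projIcc_val h _
  have hpI : ∀ s ∈ Icc t T, p s = s := fun s hs => by simp [p, projIcc_of_mem h hs]
  let w : ℝ × E → ℝ := fun q => Real.exp (c * (p q.1 - t)) * (1 + ‖q.2‖)
  have hw : ∀ q, 0 < w q := fun q => by positivity
  have hwc : Continuous w := by fun_prop
  have hw1 : ∀ q, 1 + ‖q.2‖ ≤ w q := fun q => le_mul_of_one_le_left (by positivity)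
    (Real.one_le_exp (mul_nonneg hc0.le (sub_nonneg.2 (hpm _).1)))
  have hwK : ∀ q, w q ≤ Real.exp (c * (T - t)) * (1 + ‖q.2‖) := fun q => by
    dsimp only [w]
    gcongr
    exact (hpm _).2
  have hflow : ∀ u : ℝ × E →ᵇ E, UnifLinearGrowth fun q => w q • u q := by
    refine fun u => ⟨by fun_prop, Real.exp (c * (T - t)) * ‖u‖, by positivity, fun q => ?_⟩
    rw [norm_smul, Real.norm_of_nonneg (hw q).le]
    calc w q * ‖u q‖ ≤ (Real.exp (c * (T - t)) * (1 + ‖q.2‖)) * ‖u‖ :=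
          mul_le_mul (hwK q) (u.norm_coe_le_norm q) (norm_nonneg _) (by positivity)
      _ = _ := by ring
  have hweight : ∀ Z : ℝ × E → E, UnifLinearGrowth Z →
      ∃ v : ℝ × E →ᵇ E, ∀ q, v q = (w q)⁻¹ • Z q := by
    rintro Z ⟨hZ, K, hK, hZK⟩
    refine ⟨.ofNormedAddCommGroup (fun q => (w q)⁻¹ • Z q)
      ((hwc.inv₀ fun q => (hw q).ne').smul hZ) K fun q => ?_, fun q => rfl⟩
    rw [norm_smul, norm_inv, Real.norm_of_nonneg (hw q).le, inv_mul_le_iff₀ (hw q), mul_comm]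
    exact (hZK q).trans (by gcongr; exact hw1 q)
  choose Φ hΦ using fun u => hweight _ (hb.unifLinearGrowth_picardMap hm hLb h (hflow u))
  have hcontr : ContractingWith 2⁻¹ Φ := by
    refine ⟨by norm_num, LipschitzWith.of_dist_le_mul fun u v => ?_⟩
    refine (BoundedContinuousFunction.dist_le (by positivity)).2 fun q => ?_
    have hq : ∀ Z, picardMap b h Z q = picardMap b h Z (p q.1, q.2) := fun Z => by
      simp only [picardMap, hpp]
    rw [dist_eq_norm, hΦ, hΦ, ← smul_sub, norm_smul, norm_inv, Real.norm_of_nonneg (hw q).le,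
      inv_mul_le_iff₀ (hw q), hq, hq]
    refine (hb.norm_picardMap_sub_le hm hL h (hflow u) (hflow v) hc (dist_nonneg (x := u) (y := v))
      (fun s hs x => ?_) (hpm q.1) q.2).trans_eq ?_
    · rw [← smul_sub, norm_smul, Real.norm_of_nonneg (hw _).le, mul_comm]
      simp only [w, hpI s hs]
      gcongr
      rw [← dist_eq_norm]
      exact BoundedContinuousFunction.dist_coe_le_dist _
    · simp only [w, NNReal.coe_inv, NNReal.coe_ofNat]
      ring
  refine ⟨fun q => w q • hcontr.fixedPoint Φ q, ⟨hflow _, ?_⟩, ?_⟩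
  · funext q
    conv_rhs => rw [← hcontr.fixedPoint_isFixedPt, hΦ, smul_inv_smul₀ (hw q).ne']
  · rintro Z ⟨hZ, hfix⟩
    obtain ⟨v, hv⟩ := hweight Z hZ
    have hvZ : (fun q => w q • v q) = Z := by
      funext q
      rw [hv, smul_inv_smul₀ (hw q).ne']
    have : v = hcontr.fixedPoint Φ := hcontr.fixedPoint_unique <| by
      ext q
      rw [hΦ, hvZ, hfix, hv]
    rw [← this, hvZ]

lemma IsMeanFieldDrift.norm_le_add_integral (hm : Integrable (fun y => ‖y‖) m)
    (hb : IsMeanFieldDrift m b L Lb) (h : t ≤ T) {Z : ℝ × E → E}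
    (hZ : UnifLinearGrowth Z) (hfix : picardMap b h Z = Z) {s : ℝ} (hs : s ∈ Icc t T) (x : E) :
    ‖Z (s, x)‖ ≤ ‖x‖ + ∫ τ in t..s, Lb * (1 + ‖Z (τ, x)‖ + ∫ y, ‖Z (τ, y)‖ ∂m) := by
  have hM := hZ.continuous_integral_norm hm
  have hZc := hZ.1
  conv_lhs => rw [← hfix]
  simp only [picardMap, projIcc_of_mem h hs]
  refine (norm_add_le _ _).trans (add_le_add_right ?_ _)
  exact intervalIntegral.norm_integral_le_of_norm_le hs.1
    (.of_forall fun τ _ => hb.growth _ _ _ (hZ.slice τ))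
    (Continuous.intervalIntegrable (by fun_prop) _ _)

lemma IsMeanFieldDrift.integral_norm_le [SecondCountableTopology E]
    (hm : Integrable (fun y => ‖y‖) m)
    (hb : IsMeanFieldDrift m b L Lb) (hLb : 0 ≤ Lb) (h : t ≤ T) {Z : ℝ × E → E}
    (hZ : UnifLinearGrowth Z) (hfix : picardMap b h Z = Z) {s : ℝ} (hs : s ∈ Icc t T) :
    ∫ y, ‖Z (s, y)‖ ∂m ≤
      (∫ y, ‖y‖ ∂m + Lb * (T - t)) * Real.exp (2 * Lb * (T - t)) := by
  have hM := hZ.continuous_integral_norm hm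
  have hZc := hZ.1
  have hTt : 0 ≤ T - t := sub_nonneg.2 h
  have hm0 : 0 ≤ ∫ y, ‖y‖ ∂m := integral_nonneg fun y => norm_nonneg y
  have key := le_mul_exp_of_le_add_integral (φ := fun s => ∫ y, ‖Z (s, y)‖ ∂m)
    (A := ∫ y, ‖y‖ ∂m + Lb * (T - t)) (c := 2 * Lb) (a := t) (b := T) (by positivity) hM
    (fun s hs => ?_) s hs
  · refine key.trans ?_
    gcongr
    exact hs.2
  · have : IsFiniteMeasure (volume.restrict (uIoc t s)) :=
      ⟨by simp [uIoc]⟩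
    have hprod : Integrable (Function.uncurry fun τ y =>
        Lb * (1 + ‖Z (τ, y)‖ + ∫ z, ‖Z (τ, z)‖ ∂m)) ((volume.restrict (uIoc t s)).prod m) := by
      obtain ⟨-, K, hK, hZK⟩ := hZ
      have hi : Integrable (fun q : ℝ × E => ‖Z q‖) ((volume.restrict (uIoc t s)).prod m) := by
        refine (Integrable.comp_snd (integrable_mul_one_add_norm hm K) _).mono'
          hZc.norm.aestronglyMeasurable (.of_forall fun q => ?_)
        simpa using hZK q
      have hi' : Integrable (fun τ => ∫ z, ‖Z (τ, z)‖ ∂m) (volume.restrict (uIoc t s)) :=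
        intervalIntegrable_iff.1 (hM.intervalIntegrable t s)
      exact (((integrable_const 1).add hi).add (hi'.comp_fst m)).const_mul Lb
    have hi : ∀ τ, Integrable (fun y => ‖Z (τ, y)‖) m := fun τ => (hZ.slice τ).integrable_norm hm
    calc ∫ y, ‖Z (s, y)‖ ∂m
        ≤ ∫ y, (‖y‖ + ∫ τ in t..s, Lb * (1 + ‖Z (τ, y)‖ + ∫ z, ‖Z (τ, z)‖ ∂m)) ∂m := by
          refine integral_mono (hi s) (hm.add ?_)
            fun y => hb.norm_le_add_integral hm h hZ hfix hs y
          simp only [intervalIntegral.integral_of_le hs.1]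
          rw [uIoc_of_le hs.1] at hprod
          exact hprod.integral_prod_right
      _ = ∫ y, ‖y‖ ∂m +
          ∫ τ in t..s, ∫ y, Lb * (1 + ‖Z (τ, y)‖ + ∫ z, ‖Z (τ, z)‖ ∂m) ∂m := by
          rw [intervalIntegral_integral_swap hprod, integral_add hm]
          simp only [intervalIntegral.integral_of_le hs.1]
          rw [uIoc_of_le hs.1] at hprod
          exact hprod.integral_prod_right
      _ = ∫ y, ‖y‖ ∂m + ∫ τ in t..s, (Lb + 2 * Lb * ∫ z, ‖Z (τ, z)‖ ∂m) := by
          congr 2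
          funext τ
          rw [integral_const_mul, integral_add (by exact (integrable_const _).add (hi τ))
            (integrable_const _), integral_add (integrable_const _) (hi τ)]
          simp only [integral_const, probReal_univ, one_smul]
          ring
      _ = ∫ y, ‖y‖ ∂m + Lb * (s - t) + 2 * Lb * ∫ τ in t..s, ∫ z, ‖Z (τ, z)‖ ∂m := by
          rw [intervalIntegral.integral_add (by simp)
            (Continuous.intervalIntegrable (by fun_prop) _ _),
            intervalIntegral.integral_const, intervalIntegral.integral_const_mul, smul_eq_mul]
          ring
      _ ≤ _ := by
          gcongr
          exact hs.2

lemma IsMeanFieldDrift.norm_le (hm : Integrable (fun y => ‖y‖) m)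
    (hb : IsMeanFieldDrift m b L Lb) (hLb : 0 ≤ Lb) (h : t ≤ T) {Z : ℝ × E → E}
    (hZ : UnifLinearGrowth Z) (hfix : picardMap b h Z = Z) {S : ℝ}
    (hS : ∀ s ∈ Icc t T, ∫ y, ‖Z (s, y)‖ ∂m ≤ S) {s : ℝ} (hs : s ∈ Icc t T) (x : E) :
    ‖Z (s, x)‖ ≤ (‖x‖ + Lb * (1 + S) * (T - t)) * Real.exp (Lb * (T - t)) := by
  have hM := hZ.continuous_integral_norm hm
  have hZc := hZ.1
  have hTt : 0 ≤ T - t := sub_nonneg.2 h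
  have hS0 : 0 ≤ S := (integral_nonneg fun y => norm_nonneg _).trans (hS s hs)
  have key := le_mul_exp_of_le_add_integral (φ := fun s => ‖Z (s, x)‖)
    (A := ‖x‖ + Lb * (1 + S) * (T - t)) (c := Lb) (a := t) (b := T) hLb (by fun_prop)
    (fun s hs => ?_) s hs
  · refine key.trans ?_
    gcongr
    exact hs.2
  · calc ‖Z (s, x)‖ ≤ _ := hb.norm_le_add_integral hm h hZ hfix hs x
      _ ≤ ‖x‖ + ∫ τ in t..s, (Lb * (1 + S) + Lb * ‖Z (τ, x)‖) := by
          gcongr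
          refine intervalIntegral.integral_mono_on hs.1
            (Continuous.intervalIntegrable (by fun_prop) _ _)
            (Continuous.intervalIntegrable (by fun_prop) _ _) fun τ hτ => ?_
          have := mul_le_mul_of_nonneg_left (hS τ ⟨hτ.1, hτ.2.trans hs.2⟩) hLb
          linarith
      _ = ‖x‖ + Lb * (1 + S) * (s - t) + Lb * ∫ τ in t..s, ‖Z (τ, x)‖ := by
          rw [intervalIntegral.integral_add (by simp)
            (Continuous.intervalIntegrable (by fun_prop) _ _),
            intervalIntegral.integral_const, intervalIntegral.integral_const_mul, smul_eq_mul]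
          ring
      _ ≤ _ := by
          gcongr
          exact hs.2

end MeanField

section Pushforward

variable {d : ℕ} {m : Measure (EuclideanSpace ℝ (Fin d))}
  {f g : EuclideanSpace ℝ (Fin d) → EuclideanSpace ℝ (Fin d)}

lemma mnorm1_map (hf : LinearGrowth f) : mnorm1 (m.map f) = ∫ y, ‖f y‖ ∂m :=
  integral_map hf.1.aemeasurable continuous_norm.aestronglyMeasurable

lemma MemP1.map (hm : MemP1 m) (hf : LinearGrowth f) : MemP1 (m.map f) := by
  have := hm.1
  refine ⟨Measure.isProbabilityMeasure_map hf.1.aemeasurable, ?_⟩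
  rw [integrable_map_measure continuous_norm.aestronglyMeasurable hf.1.aemeasurable]
  exact hf.integrable_norm hm.2

lemma isCoupling_map_prodMk [IsProbabilityMeasure m] (hf : Continuous f) (hg : Continuous g) :
    IsCoupling (m.map fun y => (f y, g y)) (m.map f) (m.map g) := by
  have hfg : Measurable fun y => (f y, g y) := hf.measurable.prodMk hg.measurable
  refine ⟨Measure.isProbabilityMeasure_map hfg.aemeasurable, ?_, ?_⟩
  · rw [Measure.map_map measurable_fst hfg]; rfl
  · rw [Measure.map_map measurable_snd hfg]; rfl

lemma integral_norm_sub_map_prodMk (hf : Continuous f) (hg : Continuous g) :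
    ∫ q, ‖q.1 - q.2‖ ∂(m.map fun y => (f y, g y)) = ∫ y, ‖f y - g y‖ ∂m :=
  integral_map (hf.measurable.prodMk hg.measurable).aemeasurable
    (Continuous.aestronglyMeasurable (by fun_prop))

end Pushforward

/-- Lemma 7.4, existence, uniqueness and growth estimates (7.8): the
McKean–Vlasov equation `X_s(x) = x + ∫_t^s B(τ, X_τ(x), (X_τ)_# m) dτ` with a drift that is
Lipschitz in `(x, ν)` (with `W₁` in the measure variable, via couplings) and of linear growth
has a unique jointly continuous solution of linear growth, and this solution satisfies the
stated moment and pointwise growth bounds. -/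
theorem stmt_10 (d : ℕ) (hd : 1 ≤ d) (T L Lb : ℝ) (hT : 0 < T) (hL : 0 < L) (hLb : 0 < Lb)
    (B : ℝ → EuclideanSpace ℝ (Fin d) → Measure (EuclideanSpace ℝ (Fin d)) →
      EuclideanSpace ℝ (Fin d))
    (hBcont : ∀ x ν, MemP1 ν → ContinuousOn (fun s => B s x ν) (Icc 0 T))
    (hBlip : ∀ s x x' ν ν' π, MemP1 ν → MemP1 ν' → IsCoupling π ν ν' →
      ‖B s x ν - B s x' ν'‖ ≤ L * (‖x - x'‖ + ∫ q, ‖q.1 - q.2‖ ∂π))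
    (hBgrow : ∀ s x ν, MemP1 ν → ‖B s x ν‖ ≤ Lb * (1 + ‖x‖ + mnorm1 ν))
    (t : ℝ) (ht : t ∈ Icc 0 T) (m : Measure (EuclideanSpace ℝ (Fin d))) (hm : MemP1 m) :
    ∃ X : ℝ → EuclideanSpace ℝ (Fin d) → EuclideanSpace ℝ (Fin d),
      -- `X` is a jointly continuous solution of linear growth
      (ContinuousOn (fun q : ℝ × EuclideanSpace ℝ (Fin d) => X q.1 q.2)
          (Icc t T ×ˢ (univ : Set (EuclideanSpace ℝ (Fin d)))) ∧
        (∃ K : ℝ, ∀ s ∈ Icc t T, ∀ x, ‖X s x‖ ≤ K * (1 + ‖x‖ + mnorm1 m)) ∧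
        (∀ s ∈ Icc t T, ∀ x,
          X s x = x + ∫ τ in t..s, B τ (X τ x) (Measure.map (X τ) m))) ∧
      -- uniqueness among jointly continuous solutions of linear growth
      (∀ Y : ℝ → EuclideanSpace ℝ (Fin d) → EuclideanSpace ℝ (Fin d),
        ContinuousOn (fun q : ℝ × EuclideanSpace ℝ (Fin d) => Y q.1 q.2)
          (Icc t T ×ˢ (univ : Set (EuclideanSpace ℝ (Fin d)))) →
        (∃ K : ℝ, ∀ s ∈ Icc t T, ∀ x, ‖Y s x‖ ≤ K * (1 + ‖x‖ + mnorm1 m)) →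
        (∀ s ∈ Icc t T, ∀ x,
          Y s x = x + ∫ τ in t..s, B τ (Y τ x) (Measure.map (Y τ) m)) →
        ∀ s ∈ Icc t T, ∀ x, Y s x = X s x) ∧
      -- moment growth estimate
      (∀ s ∈ Icc t T,
        (∫ y, ‖X s y‖ ∂m) ≤ (mnorm1 m + Lb * (T - t)) * Real.exp (2 * Lb * (T - t))) ∧
      -- pointwise growth estimate
      (∀ x, ∀ s ∈ Icc t T,
        ‖X s x‖ ≤
          (‖x‖ + Lb * (1 + sSup ((fun s => ∫ y, ‖X s y‖ ∂m) '' Icc t T)) * (T - t)) *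
            Real.exp (Lb * (T - t))) := by
  have hprob := hm.1
  let p : ℝ → ℝ := fun s => projIcc t T ht.2 s
  have hp : Continuous p := continuous_coe_projIcc ht.2
  have hpm : ∀ s, p s ∈ Icc t T := fun s => (projIcc t T ht.2 s).2
  have hpI : ∀ s ∈ Icc t T, p s = s := fun s hs => by simp [p, projIcc_of_mem ht.2 hs]
  have hm0 : 0 ≤ mnorm1 m := integral_nonneg fun y => norm_nonneg y
  let b : ℝ → EuclideanSpace ℝ (Fin d) →
      (EuclideanSpace ℝ (Fin d) → EuclideanSpace ℝ (Fin d)) → EuclideanSpace ℝ (Fin d) :=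
    fun s x f => B (p s) x (m.map f)
  have hb : IsMeanFieldDrift m b L Lb := by
    refine ⟨fun x f hf => ?_, fun s x x' f g hf hg => ?_, fun s x f hf => ?_⟩
    · exact (hBcont x _ (hm.map hf)).comp_continuous hp
        fun s => ⟨ht.1.trans (hpm s).1, (hpm s).2⟩
    · rw [← integral_norm_sub_map_prodMk hf.1 hg.1]
      exact hBlip _ _ _ _ _ _ (hm.map hf) (hm.map hg) (isCoupling_map_prodMk hf.1 hg.1)
    · rw [← mnorm1_map hf]
      exact hBgrow _ _ _ (hm.map hf)
  have hdrift : ∀ s ∈ Icc t T, ∀ (Z : ℝ × EuclideanSpace ℝ (Fin d) → EuclideanSpace ℝ (Fin d)) x,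
      picardMap b ht.2 Z (s, x) =
        x + ∫ τ in t..s, B τ (Z (τ, x)) (m.map fun y => Z (τ, y)) := by
    intro s hs Z x
    simp only [picardMap, projIcc_of_mem ht.2 hs]
    congr 1
    refine intervalIntegral.integral_congr fun τ hτ => ?_
    rw [uIcc_of_le hs.1] at hτ
    simp only [b, hpI τ ⟨hτ.1, hτ.2.trans hs.2⟩]
  obtain ⟨Z, ⟨hZ, hfix⟩, huniq⟩ := hb.existsUnique_picardMap_eq hm.2 hL hLb.le ht.2
  have hmom : ∀ s ∈ Icc t T, (∫ y, ‖Z (s, y)‖ ∂m) ≤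
      (mnorm1 m + Lb * (T - t)) * Real.exp (2 * Lb * (T - t)) :=
    fun s hs => hb.integral_norm_le hm.2 hLb.le ht.2 hZ hfix hs
  refine ⟨fun s x => Z (s, x), ⟨hZ.1.continuousOn, ?_, fun s hs x => ?_⟩, ?_, hmom, fun x s hs => ?_⟩
  · obtain ⟨-, K, hK, hZK⟩ := hZ
    refine ⟨K, fun s _ x => (hZK (s, x)).trans ?_⟩
    exact mul_le_mul_of_nonneg_left (le_add_of_nonneg_right hm0) hK
  · conv_lhs => rw [← hfix]
    exact hdrift s hs Z x
  · rintro Y hY ⟨K, hYK⟩ hYfix s hs x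
    have hYZ := huniq (fun q => Y (p q.1) q.2) ⟨⟨?_, |K| * (1 + mnorm1 m), by positivity, ?_⟩, ?_⟩
    · rw [← hYZ]
      simp only [hpI s hs]
    · exact hY.comp_continuous (f := fun q : ℝ × EuclideanSpace ℝ (Fin d) => (p q.1, q.2))
        (by fun_prop) fun q => ⟨hpm q.1, mem_univ _⟩
    · intro q
      refine (hYK _ (hpm q.1) q.2).trans ?_
      rw [mul_assoc]
      gcongr
      · exact le_abs_self K
      · nlinarith [mul_nonneg hm0 (norm_nonneg q.2)]
    · funext q
      have hq : ∀ W, picardMap b ht.2 W q = picardMap b ht.2 W (p q.1, q.2) := fun W => by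
        simp only [picardMap, p, projIcc_val]
      rw [hq, hdrift _ (hpm q.1), hYfix _ (hpm q.1)]
      congr 1
      refine intervalIntegral.integral_congr fun τ hτ => ?_
      rw [uIcc_of_le (hpm q.1).1] at hτ
      simp only [hpI τ ⟨hτ.1, hτ.2.trans (hpm q.1).2⟩]
  · refine hb.norm_le hm.2 hLb.le ht.2 hZ hfix (fun s hs => ?_) hs x
    exact le_csSup ⟨_, forall_mem_image.2 hmom⟩ (mem_image_of_mem _ hs)
end

section
/- In the McKean–Vlasov setting of Lemma 7.4 — B : [0,T] × ℝ^d × P₁ → ℝ^d continuous in s for fixed (x,ν), satisfying ‖B(s,x,ν) − B(s,x',ν')‖ ≤ L(‖x−x'‖ + ∫‖y−y'‖dπ) for every coupling π of ν and ν', and ‖B(s,x,ν)‖ ≤ L̄(1+‖x‖+‖ν‖₁) — let m ∈ P₁ and 0 ≤ t ≤ s ≤ τ ≤ T, and let X^{t,m} denote the unique jointly continuous linear-growth solution with initial time t and initial measure m. Set ν := (X^{t,m}_s)_#m, the pushforward of m by X^{t,m}_s. Then the flow property holds: X^{t,m}_τ(x) = X^{s,ν}_τ(X^{t,m}_s(x))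 for every x ∈ ℝ^d; in particular (X^{t,m}_τ)_#m = (X^{s,ν}_τ)_#ν. -/
open MeasureTheory Set

open Filter Topology

lemma MemP1.integrable_of_norm_le {d : ℕ} {m : Measure (EuclideanSpace ℝ (Fin d))} (hm : MemP1 m)
    {f : EuclideanSpace ℝ (Fin d) → EuclideanSpace ℝ (Fin d)} (hf : Continuous f) {C : ℝ}
    (hC : ∀ x, ‖f x‖ ≤ C * (1 + ‖x‖)) : Integrable f m := by
  have := hm.1
  exact (((integrable_const (1 : ℝ)).add hm.2).const_mul C).mono' hf.aestronglyMeasurable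
    (ae_of_all _ hC)

lemma MemP1.map_of_norm_le {d : ℕ} {m : Measure (EuclideanSpace ℝ (Fin d))} (hm : MemP1 m)
    {f : EuclideanSpace ℝ (Fin d) → EuclideanSpace ℝ (Fin d)} (hf : Continuous f) {C : ℝ}
    (hC : ∀ x, ‖f x‖ ≤ C * (1 + ‖x‖)) : MemP1 (m.map f) := by
  have := hm.1
  refine ⟨Measure.isProbabilityMeasure_map hf.aemeasurable, ?_⟩
  rw [integrable_map_measure continuous_norm.aestronglyMeasurable hf.aemeasurable]
  exact (hm.integrable_of_norm_le hf hC).norm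

/-- The joint law of `(f, g)` under `m` couples the pushforwards, which turns the Lipschitz
condition on `B` into an estimate by `∫ ‖f - g‖ dm`. -/
lemma norm_sub_le_of_coupling_map {d : ℕ} {L : ℝ}
    {b : EuclideanSpace ℝ (Fin d) → Measure (EuclideanSpace ℝ (Fin d)) →
      EuclideanSpace ℝ (Fin d)}
    (hb : ∀ x x' ν ν' π, MemP1 ν → MemP1 ν' → IsCoupling π ν ν' →
      ‖b x ν - b x' ν'‖ ≤ L * (‖x - x'‖ + ∫ q, ‖q.1 - q.2‖ ∂π))
    {m : Measure (EuclideanSpace ℝ (Fin d))} (hm : MemP1 m)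
    {f g : EuclideanSpace ℝ (Fin d) → EuclideanSpace ℝ (Fin d)} (hf : Continuous f)
    (hg : Continuous g) {C C' : ℝ} (hC : ∀ x, ‖f x‖ ≤ C * (1 + ‖x‖))
    (hC' : ∀ x, ‖g x‖ ≤ C' * (1 + ‖x‖)) (x x' : EuclideanSpace ℝ (Fin d)) :
    ‖b x (m.map f) - b x' (m.map g)‖ ≤ L * (‖x - x'‖ + ∫ y, ‖f y - g y‖ ∂m) := by
  have := hm.1
  have hfg : Continuous fun y => (f y, g y) := hf.prodMk hg
  have hπ : IsCoupling (m.map fun y => (f y, g y)) (m.map f) (m.map g) := by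
    refine ⟨Measure.isProbabilityMeasure_map hfg.aemeasurable, ?_, ?_⟩
    · rw [Measure.map_map measurable_fst hfg.measurable]; rfl
    · rw [Measure.map_map measurable_snd hfg.measurable]; rfl
  refine (hb x x' _ _ _ (hm.map_of_norm_le hf hC) (hm.map_of_norm_le hg hC') hπ).trans_eq ?_
  have hq : Continuous fun q : EuclideanSpace ℝ (Fin d) × EuclideanSpace ℝ (Fin d) =>
    ‖q.1 - q.2‖ := by fun_prop
  rw [integral_map hfg.aemeasurable hq.aestronglyMeasurable]

lemma continuousOn_drift {d : ℕ} {S : Set ℝ} {L : ℝ}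
    {B : ℝ → EuclideanSpace ℝ (Fin d) → Measure (EuclideanSpace ℝ (Fin d)) →
      EuclideanSpace ℝ (Fin d)}
    (hBcont : ∀ x ν, MemP1 ν → ContinuousOn (fun s => B s x ν) S)
    (hBlip : ∀ s x x' ν ν' π, MemP1 ν → MemP1 ν' → IsCoupling π ν ν' →
      ‖B s x ν - B s x' ν'‖ ≤ L * (‖x - x'‖ + ∫ q, ‖q.1 - q.2‖ ∂π))
    {m : Measure (EuclideanSpace ℝ (Fin d))} (hm : MemP1 m)
    {F : ℝ → EuclideanSpace ℝ (Fin d) → EuclideanSpace ℝ (Fin d)}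
    (hF : ∀ σ ∈ S, Continuous (F σ)) (hFt : ∀ x, ContinuousOn (fun σ => F σ x) S)
    {C : ℝ} (hC : ∀ σ ∈ S, ∀ x, ‖F σ x‖ ≤ C * (1 + ‖x‖)) (x : EuclideanSpace ℝ (Fin d)) :
    ContinuousOn (fun τ => B τ (F τ x) (m.map (F τ))) S := by
  have := hm.1
  intro σ hσ
  have hlaw : Tendsto (fun τ => ∫ y, ‖F τ y - F σ y‖ ∂m) (𝓝[S] σ) (𝓝 0) := by
    have h := tendsto_integral_filter_of_dominated_convergence (μ := m) (l := 𝓝[S] σ)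
      (F := fun τ y => ‖F τ y - F σ y‖) (f := fun _ => (0 : ℝ))
      (fun y => 2 * C * (1 + ‖y‖)) ?_ ?_ ?_ ?_
    · simpa using h
    · filter_upwards [self_mem_nhdsWithin] with τ hτ
      exact ((hF τ hτ).sub (hF σ hσ)).norm.aestronglyMeasurable
    · filter_upwards [self_mem_nhdsWithin] with τ hτ
      refine ae_of_all _ fun y => ?_
      rw [norm_norm]
      have := norm_sub_le (F τ y) (F σ y)
      linarith [hC τ hτ y, hC σ hσ y]
    · exact ((integrable_const (1 : ℝ)).add hm.2).const_mul (2 * C)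
    · refine ae_of_all _ fun y => ?_
      simpa using ((hFt y σ hσ).tendsto.sub_const (F σ y)).norm
  have hx : Tendsto (fun τ => ‖F τ x - F σ x‖) (𝓝[S] σ) (𝓝 0) := by
    simpa using ((hFt x σ hσ).tendsto.sub_const (F σ x)).norm
  have hB : Tendsto (fun τ => ‖B τ (F σ x) (m.map (F σ)) - B σ (F σ x) (m.map (F σ))‖)
      (𝓝[S] σ) (𝓝 0) := by
    simpa using ((hBcont (F σ x) _ (hm.map_of_norm_le (hF σ hσ) (hC σ hσ)) σ hσ).tendsto.sub_const
      (B σ (F σ x) (m.map (F σ)))).norm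
  rw [ContinuousWithinAt, tendsto_iff_norm_sub_tendsto_zero]
  have hsum := ((hx.add hlaw).const_mul L).add hB
  simp only [add_zero, mul_zero] at hsum
  refine squeeze_zero' (Eventually.of_forall fun _ => norm_nonneg _) ?_ hsum
  filter_upwards [self_mem_nhdsWithin] with τ hτ
  refine (norm_sub_le_norm_sub_add_norm_sub _ (B τ (F σ x) (m.map (F σ))) _).trans ?_
  gcongr
  exact norm_sub_le_of_coupling_map (hBlip τ) hm (hF τ hτ) (hF σ hσ) (hC τ hτ) (hC σ hσ) _ _

/-- Two solutions of the McKean–Vlasov integral equation with linear growth and the same value at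
the initial time coincide. -/
lemma eq_of_integral_eq {d : ℕ} {s T L : ℝ} (hL : 0 ≤ L)
    {B : ℝ → EuclideanSpace ℝ (Fin d) → Measure (EuclideanSpace ℝ (Fin d)) →
      EuclideanSpace ℝ (Fin d)}
    (hBcont : ∀ x ν, MemP1 ν → ContinuousOn (fun s => B s x ν) (Icc s T))
    (hBlip : ∀ s x x' ν ν' π, MemP1 ν → MemP1 ν' → IsCoupling π ν ν' →
      ‖B s x ν - B s x' ν'‖ ≤ L * (‖x - x'‖ + ∫ q, ‖q.1 - q.2‖ ∂π))
    {m : Measure (EuclideanSpace ℝ (Fin d))} (hm : MemP1 m)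
    {F G : ℝ → EuclideanSpace ℝ (Fin d) → EuclideanSpace ℝ (Fin d)}
    {ξ : EuclideanSpace ℝ (Fin d) → EuclideanSpace ℝ (Fin d)} {C C' : ℝ}
    (hF : ∀ σ ∈ Icc s T, Continuous (F σ)) (hFt : ∀ x, ContinuousOn (fun σ => F σ x) (Icc s T))
    (hFC : ∀ σ ∈ Icc s T, ∀ x, ‖F σ x‖ ≤ C * (1 + ‖x‖))
    (hFeq : ∀ σ ∈ Icc s T, ∀ x, F σ x = ξ x + ∫ τ in s..σ, B τ (F τ x) (m.map (F τ)))
    (hG : ∀ σ ∈ Icc s T, Continuous (G σ)) (hGt : ∀ x, ContinuousOn (fun σ => G σ x) (Icc s T))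
    (hGC : ∀ σ ∈ Icc s T, ∀ x, ‖G σ x‖ ≤ C' * (1 + ‖x‖))
    (hGeq : ∀ σ ∈ Icc s T, ∀ x, G σ x = ξ x + ∫ τ in s..σ, B τ (G τ x) (m.map (G τ))) :
    ∀ σ ∈ Icc s T, ∀ x, F σ x = G σ x := by
  have := hm.1
  set M : ℝ := ∫ y, (1 + ‖y‖) ∂m with hM
  have hM0 : 0 ≤ M := integral_nonneg fun y => by positivity
  obtain ⟨A, hA⟩ : ∃ A : ℝ, A = L * (1 + M) := ⟨_, rfl⟩
  have hint : Integrable (fun y : EuclideanSpace ℝ (Fin d) => 1 + ‖y‖) m :=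
    (integrable_const (1 : ℝ)).add hm.2
  have hbound : ∀ n : ℕ, ∀ σ ∈ Icc s T, ∀ x,
      ‖F σ x - G σ x‖ ≤ (C + C') * ((A * (σ - s)) ^ n / n.factorial) * (1 + ‖x‖) := by
    intro n
    induction n with
    | zero =>
      intro σ hσ x
      have := norm_sub_le (F σ x) (G σ x)
      simp only [pow_zero, Nat.factorial_zero, Nat.cast_one, div_one, mul_one]
      linarith [hFC σ hσ x, hGC σ hσ x]
    | succ n ih =>
      intro σ hσ x
      have hsub : Icc s σ ⊆ Icc s T := Icc_subset_Icc_right hσ.2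
      have hFi : IntervalIntegrable (fun τ => B τ (F τ x) (m.map (F τ))) volume s σ :=
        ContinuousOn.intervalIntegrable_of_Icc hσ.1
          ((continuousOn_drift hBcont hBlip hm hF hFt hFC x).mono hsub)
      have hGi : IntervalIntegrable (fun τ => B τ (G τ x) (m.map (G τ))) volume s σ :=
        ContinuousOn.intervalIntegrable_of_Icc hσ.1
          ((continuousOn_drift hBcont hBlip hm hG hGt hGC x).mono hsub)
      rw [hFeq σ hσ x, hGeq σ hσ x, add_sub_add_left_eq_sub, ← intervalIntegral.integral_sub hFi hGi]
      set c : ℝ := (C + C') * (A ^ (n + 1) / n.factorial) * (1 + ‖x‖) with hc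
      have hle : ‖∫ τ in s..σ, (B τ (F τ x) (m.map (F τ)) - B τ (G τ x) (m.map (G τ)))‖ ≤
          ∫ τ in s..σ, c * (τ - s) ^ n := by
        refine intervalIntegral.norm_integral_le_of_norm_le hσ.1 (ae_of_all _ fun τ hτ => ?_)
          (Continuous.intervalIntegrable (by fun_prop) _ _)
        have hτ' : τ ∈ Icc s T := hsub (Ioc_subset_Icc_self hτ)
        refine (norm_sub_le_of_coupling_map (hBlip τ) hm (hF τ hτ') (hG τ hτ') (hFC τ hτ')
          (hGC τ hτ') _ _).trans ?_
        set e : ℝ := (C + C') * ((A * (τ - s)) ^ n / n.factorial) with he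
        have he0 : 0 ≤ e := by
          have := (norm_nonneg _).trans (ih τ hτ' x)
          exact nonneg_of_mul_nonneg_left this (by positivity)
        have hmean : ∫ y, ‖F τ y - G τ y‖ ∂m ≤ e * M := by
          rw [hM, ← integral_const_mul]
          exact integral_mono_of_nonneg (ae_of_all _ fun y => norm_nonneg _) (hint.const_mul e)
            (ae_of_all _ (ih τ hτ'))
        have hstep : L * (‖F τ x - G τ x‖ + ∫ y, ‖F τ y - G τ y‖ ∂m) ≤
            L * (e * (1 + ‖x‖) + e * M * (1 + ‖x‖)) := by
          gcongr
          · exact ih τ hτ' x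
          · refine hmean.trans (le_mul_of_one_le_right (by positivity) ?_)
            linarith [norm_nonneg x]
        refine hstep.trans_eq ?_
        have hAe : L * (e * (1 + ‖x‖) + e * M * (1 + ‖x‖)) = A * e * (1 + ‖x‖) := by
          rw [hA]
          ring
        rw [hAe, hc, he, mul_pow]
        ring
      refine hle.trans_eq ?_
      rw [intervalIntegral.integral_const_mul,
        intervalIntegral.integral_comp_sub_right (fun τ => τ ^ n) s, sub_self, integral_pow, hc,
        Nat.factorial_succ, mul_pow]
      push_cast
      field_simp
      ring
  intro σ hσ x
  have hlim : Tendsto (fun n : ℕ => (C + C') * ((A * (σ - s)) ^ n / n.factorial) * (1 + ‖x‖))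
      atTop (𝓝 0) := by
    simpa using ((FloorSemiring.tendsto_pow_div_factorial_atTop (A * (σ - s))).const_mul
      (C + C')).mul_const (1 + ‖x‖)
  exact sub_eq_zero.1 (norm_le_zero_iff.1 (ge_of_tendsto' hlim fun n => hbound n σ hσ x))

lemma mul_one_add_add_le {K a r : ℝ} (ha : 0 ≤ a) (hr : 0 ≤ r) :
    K * (1 + r + a) ≤ |K| * (1 + a) * (1 + r) := by
  have h : K * (1 + r + a) ≤ |K| * (1 + r + a) := by gcongr; exact le_abs_self K
  nlinarith [mul_nonneg (abs_nonneg K) (mul_nonneg ha hr)]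

/-- flow property (7.15) of the forward McKean–Vlasov flow:
`X^{t,m}_τ(x) = X^{s,ν}_τ(X^{t,m}_s(x))` with `ν = (X^{t,m}_s)_# m`, and in particular
`(X^{t,m}_τ)_# m = (X^{s,ν}_τ)_# ν`. -/
theorem stmt_14 (d : ℕ) (hd : 1 ≤ d) (T L Lb : ℝ) (hT : 0 < T) (hL : 0 < L) (hLb : 0 < Lb)
    (B : ℝ → EuclideanSpace ℝ (Fin d) → Measure (EuclideanSpace ℝ (Fin d)) →
      EuclideanSpace ℝ (Fin d))
    (hBcont : ∀ x ν, MemP1 ν → ContinuousOn (fun s => B s x ν) (Icc 0 T))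
    (hBlip : ∀ s x x' ν ν' π, MemP1 ν → MemP1 ν' → IsCoupling π ν ν' →
      ‖B s x ν - B s x' ν'‖ ≤ L * (‖x - x'‖ + ∫ q, ‖q.1 - q.2‖ ∂π))
    (hBgrow : ∀ s x ν, MemP1 ν → ‖B s x ν‖ ≤ Lb * (1 + ‖x‖ + mnorm1 ν))
    (t s : ℝ) (ht : 0 ≤ t) (hts : t ≤ s) (hsT : s ≤ T)
    (m : Measure (EuclideanSpace ℝ (Fin d))) (hm : MemP1 m)
    -- `X` is the unique jointly continuous linear-growth solution with data `(t, m)`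
    (X : ℝ → EuclideanSpace ℝ (Fin d) → EuclideanSpace ℝ (Fin d))
    (hXcont : ContinuousOn (fun q : ℝ × EuclideanSpace ℝ (Fin d) => X q.1 q.2)
      (Icc t T ×ˢ (univ : Set (EuclideanSpace ℝ (Fin d)))))
    (hXgrow : ∃ K : ℝ, ∀ σ ∈ Icc t T, ∀ x, ‖X σ x‖ ≤ K * (1 + ‖x‖ + mnorm1 m))
    (hXeq : ∀ σ ∈ Icc t T, ∀ x,
      X σ x = x + ∫ τ in t..σ, B τ (X τ x) (Measure.map (X τ) m))
    -- `Y` is the unique jointly continuous linear-growth solution with data `(s, ν)`,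
    -- where `ν = (X^{t,m}_s)_# m`
    (Y : ℝ → EuclideanSpace ℝ (Fin d) → EuclideanSpace ℝ (Fin d))
    (hYcont : ContinuousOn (fun q : ℝ × EuclideanSpace ℝ (Fin d) => Y q.1 q.2)
      (Icc s T ×ˢ (univ : Set (EuclideanSpace ℝ (Fin d)))))
    (hYgrow : ∃ K : ℝ, ∀ σ ∈ Icc s T, ∀ x,
      ‖Y σ x‖ ≤ K * (1 + ‖x‖ + mnorm1 (Measure.map (X s) m)))
    (hYeq : ∀ σ ∈ Icc s T, ∀ x,
      Y σ x = x + ∫ τ in s..σ, B τ (Y τ x) (Measure.map (Y τ) (Measure.map (X s) m))) :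
    ∀ τ ∈ Icc s T,
      (∀ x : EuclideanSpace ℝ (Fin d), X τ x = Y τ (X s x)) ∧
      Measure.map (X τ) m = Measure.map (Y τ) (Measure.map (X s) m) := by
  have hts' : Icc s T ⊆ Icc t T := Icc_subset_Icc_left hts
  have h0t : Icc t T ⊆ Icc 0 T := Icc_subset_Icc_left ht
  have hsmem : s ∈ Icc t T := ⟨hts, hsT⟩
  have hX : ∀ σ ∈ Icc t T, Continuous (X σ) := fun σ hσ =>
    hXcont.comp_continuous (by fun_prop : Continuous fun x => (σ, x)) fun x => ⟨hσ, mem_univ x⟩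
  have hXt : ∀ x, ContinuousOn (fun σ => X σ x) (Icc t T) := fun x =>
    hXcont.comp (by fun_prop : ContinuousOn (fun σ : ℝ => (σ, x)) (Icc t T))
      fun σ hσ => ⟨hσ, mem_univ x⟩
  have hY : ∀ σ ∈ Icc s T, Continuous (Y σ) := fun σ hσ =>
    hYcont.comp_continuous (by fun_prop : Continuous fun x => (σ, x)) fun x => ⟨hσ, mem_univ x⟩
  have hYt : ∀ x, ContinuousOn (fun σ => Y σ x) (Icc s T) := fun x =>
    hYcont.comp (by fun_prop : ContinuousOn (fun σ : ℝ => (σ, x)) (Icc s T))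
      fun σ hσ => ⟨hσ, mem_univ x⟩
  have hmap : ∀ σ ∈ Icc s T,
      Measure.map (Y σ) (Measure.map (X s) m) = Measure.map (fun x => Y σ (X s x)) m := fun σ hσ =>
    Measure.map_map (hY σ hσ).measurable (hX s hsmem).measurable
  obtain ⟨K, hK⟩ := hXgrow
  obtain ⟨K', hK'⟩ := hYgrow
  have hnonneg : ∀ ν : Measure (EuclideanSpace ℝ (Fin d)), 0 ≤ mnorm1 ν := fun ν =>
    integral_nonneg fun y => norm_nonneg y
  set C : ℝ := |K| * (1 + mnorm1 m) with hCdef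
  have hC : ∀ σ ∈ Icc t T, ∀ x, ‖X σ x‖ ≤ C * (1 + ‖x‖) := fun σ hσ x =>
    (hK σ hσ x).trans (mul_one_add_add_le (hnonneg m) (norm_nonneg x))
  set C' : ℝ := |K'| * (1 + mnorm1 (Measure.map (X s) m)) with hC'def
  have hC'0 : 0 ≤ C' := mul_nonneg (abs_nonneg _) (add_nonneg zero_le_one (hnonneg _))
  have hYC : ∀ σ ∈ Icc s T, ∀ x, ‖Y σ (X s x)‖ ≤ C' * (1 + C) * (1 + ‖x‖) := by
    intro σ hσ x
    refine ((hK' σ hσ (X s x)).trans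
      (mul_one_add_add_le (hnonneg _) (norm_nonneg (X s x)))).trans ?_
    rw [mul_assoc C']
    refine mul_le_mul_of_nonneg_left ?_ hC'0
    linarith [hC s hsmem x, norm_nonneg x]
  have hXrestart : ∀ σ ∈ Icc s T, ∀ x,
      X σ x = X s x + ∫ τ in s..σ, B τ (X τ x) (Measure.map (X τ) m) := by
    intro σ hσ x
    have hcont := continuousOn_drift (fun x ν hν => (hBcont x ν hν).mono h0t) hBlip hm hX hXt hC x
    have hi₁ := ContinuousOn.intervalIntegrable_of_Icc (μ := volume) hts
      (hcont.mono (Icc_subset_Icc_right hsT))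
    have hi₂ := ContinuousOn.intervalIntegrable_of_Icc (μ := volume) hσ.1
      (hcont.mono (Icc_subset_Icc hts hσ.2))
    rw [hXeq σ (hts' hσ) x, hXeq s hsmem x, add_assoc,
      intervalIntegral.integral_add_adjacent_intervals hi₁ hi₂]
  have hYrestart : ∀ σ ∈ Icc s T, ∀ x, Y σ (X s x) = X s x +
      ∫ τ in s..σ, B τ (Y τ (X s x)) (Measure.map (fun y => Y τ (X s y)) m) := by
    intro σ hσ x
    rw [hYeq σ hσ (X s x)]
    congr 1
    refine intervalIntegral.integral_congr fun τ hτ => ?_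
    rw [uIcc_of_le hσ.1] at hτ
    simp only [hmap τ ⟨hτ.1, hτ.2.trans hσ.2⟩]
  have heq := eq_of_integral_eq (ξ := X s) (F := X) (G := fun σ x => Y σ (X s x)) hL.le
    (fun x ν hν => (hBcont x ν hν).mono (hts'.trans h0t)) hBlip hm
    (fun σ hσ => hX σ (hts' hσ)) (fun x => (hXt x).mono hts') (fun σ hσ => hC σ (hts' hσ))
    hXrestart (fun σ hσ => (hY σ hσ).comp (hX s hsmem)) (fun x => hYt (X s x)) hYC hYrestart
  intro τ hτ
  refine ⟨heq τ hτ, ?_⟩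
  rw [hmap τ hτ]
  congr 1
  exact funext (heq τ hτ)
end
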